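/- Let k be a field of characteristic zero, R = k[x_1, ..., x_N], and P a prime ideal of R. Then for every positive integer n, the n-th symbolic power of P equals the n-th differential power of P: P^(n) = { f ∈ R : ∂^{a_1+...+a_N} f / ∂x_1^{a_1}···∂x_N^{a_N} ∈ P for all nonnegative integers a_1, ..., a_N with a_1 + ... + a_N ≤ n − 1 }. -/

import Mathlib

/-- The `n`-th symbolic power of an ideal `I`: the intersection, over the associated
primes `P` of `R/I`, of the contractions of `IⁿR_P` along the localization maps. -/
noncomputable def symbolicPower {R : Type*} [CommRing R] (I : Ideal R) (n : ℕ) : Ideal R :=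
  ⨅ (P : Ideal R) (hP : IsAssociatedPrime P (R ⧸ I)),
    letI := hP.isPrime
    Ideal.comap (algebraMap R (Localization.AtPrime P))
      (Ideal.map (algebraMap R (Localization.AtPrime P)) (I ^ n))

/-- The iterated formal partial derivative `∂^{a₁+⋯+a_N} / ∂x₁^{a₁} ⋯ ∂x_N^{a_N}`. -/
noncomputable def iteratedPDeriv {k : Type*} [CommSemiring k] {N : ℕ} (a : Fin N → ℕ)
    (f : MvPolynomial (Fin N) k) : MvPolynomial (Fin N) k :=
  (((List.finRange N).map fun i =>
    ((MvPolynomial.pderiv i).toLinearMap : Module.End k (MvPolynomial (Fin N) k)) ^ (a i)).prod) f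

theorem Derivation.sum_apply {ι R A M : Type*} [CommSemiring R] [CommSemiring A]
    [AddCommMonoid M] [Algebra R A] [Module A M] [Module R M] (s : Finset ι)
    (D : ι → Derivation R A M) (a : A) : (∑ i ∈ s, D i) a = ∑ i ∈ s, D i a := by
  rw [← coeFnAddMonoidHom_apply, map_sum, Finset.sum_apply]
  rfl

namespace MvPolynomial

theorem derivation_eq_sum_pderiv_smul {σ k M : Type*} [Fintype σ] [CommSemiring k]
    [AddCommMonoid M] [Module k M] [Module (MvPolynomial σ k) M]
    [IsScalarTower k (MvPolynomial σ k) M]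
    (D : Derivation k (MvPolynomial σ k) M) (f : MvPolynomial σ k) :
    D f = ∑ i, pderiv i f • D (X i) := by
  classical
  have h : D = ∑ i, (LinearMap.toSpanSingleton (MvPolynomial σ k) M (D (X i))).compDer
      (pderiv i) := by
    refine derivation_ext fun j => ?_
    simp [Derivation.sum_apply, pderiv_X, Pi.single_apply]
  conv_lhs => rw [h]
  simp [Derivation.sum_apply]

theorem commute_pderiv {σ k : Type*} [CommRing k] (i j : σ) :
    Commute ((pderiv (R := k) i).toLinearMap : Module.End k (MvPolynomial σ k))
      (pderiv (R := k) j).toLinearMap := by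
  classical
  have h : ⁅pderiv (R := k) i, pderiv (R := k) j⁆ = 0 := by
    refine derivation_ext fun l => ?_
    simp [Derivation.commutator_apply, pderiv_X, Pi.single_apply, apply_ite]
  refine LinearMap.ext fun f => ?_
  have hf := DFunLike.congr_fun h f
  rw [Derivation.commutator_apply] at hf
  exact sub_eq_zero.mp hf

end MvPolynomial

theorem List.prod_map_pow_add_single {ι M : Type*} [DecidableEq ι] [Monoid M] (g : ι → M)
    (hg : ∀ i j, Commute (g i) (g j)) (a : ι → ℕ) (i : ι) (l : List ι) (hl : l.Nodup)
    (hi : i ∈ l) :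
    (l.map fun j => g j ^ (a + Pi.single i 1 : ι → ℕ) j).prod =
      (l.map fun j => g j ^ a j).prod * g i := by
  induction l with
  | nil => simp at hi
  | cons x l ih =>
    obtain ⟨hx, hl⟩ := List.nodup_cons.mp hl
    simp only [List.map_cons, List.prod_cons]
    by_cases h : i = x
    · subst h
      have hmap : (l.map fun j => g j ^ (a + Pi.single i 1 : ι → ℕ) j) =
          l.map fun j => g j ^ a j := by
        refine List.map_congr_left fun j hj => ?_
        have : j ≠ i := fun h => hx (h ▸ hj)
        simp [this]
      have hc : Commute (g i) (l.map fun j => g j ^ a j).prod :=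
        Commute.list_prod_right _ _ fun y hy => by
          obtain ⟨j, -, rfl⟩ := List.mem_map.mp hy
          exact (hg i j).pow_right _
      rw [hmap, Pi.add_apply, Pi.single_eq_same, pow_succ, mul_assoc, mul_assoc, hc.eq]
    · rw [ih hl ((List.mem_cons.mp hi).resolve_left h), Pi.add_apply,
        Pi.single_eq_of_ne (Ne.symm h), add_zero, mul_assoc]

section iteratedPDeriv

variable {k : Type*} [CommRing k] {N : ℕ}

theorem iteratedPDeriv_zero (f : MvPolynomial (Fin N) k) : iteratedPDeriv 0 f = f := by
  simp [iteratedPDeriv]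

theorem iteratedPDeriv_add_single (a : Fin N → ℕ) (i : Fin N) (f : MvPolynomial (Fin N) k) :
    iteratedPDeriv (a + Pi.single i 1) f = iteratedPDeriv a (MvPolynomial.pderiv i f) := by
  unfold iteratedPDeriv
  rw [List.prod_map_pow_add_single _ MvPolynomial.commute_pderiv a i _ (List.nodup_finRange N)
    (List.mem_finRange i)]
  rfl

theorem forall_iteratedPDeriv_mem_succ_iff (P : Ideal (MvPolynomial (Fin N) k)) (m : ℕ)
    (f : MvPolynomial (Fin N) k) :
    (∀ a : Fin N → ℕ, ∑ i, a i ≤ m + 1 → iteratedPDeriv a f ∈ P) ↔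
      f ∈ P ∧ ∀ i, ∀ a : Fin N → ℕ, ∑ i, a i ≤ m →
        iteratedPDeriv a (MvPolynomial.pderiv i f) ∈ P := by
  refine ⟨fun h => ⟨iteratedPDeriv_zero f ▸ h 0 (by simp), fun i a ha => ?_⟩,
    fun ⟨h0, h1⟩ a ha => ?_⟩
  · rw [← iteratedPDeriv_add_single]
    refine h _ ?_
    simpa [Finset.sum_add_distrib] using ha
  · by_cases h : a = 0
    · rwa [h, iteratedPDeriv_zero]
    · obtain ⟨i, hi⟩ := Function.ne_iff.mp h
      have hle : Pi.single i 1 ≤ a := by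
        intro j
        by_cases hj : j = i
        · subst hj
          simpa [Nat.one_le_iff_ne_zero] using hi
        · simp [hj]
      obtain ⟨b, rfl⟩ : ∃ b : Fin N → ℕ, a = b + Pi.single i 1 :=
        ⟨a - Pi.single i 1, (tsub_add_cancel_of_le hle).symm⟩
      rw [iteratedPDeriv_add_single]
      refine h1 i b ?_
      simpa [Finset.sum_add_distrib] using ha

end iteratedPDeriv

section symbolicPower

open IsLocalRing

variable {R : Type*} [CommRing R] (P : Ideal R) [P.IsPrime]

theorem symbolicPower_eq_comap [IsNoetherianRing R] (n : ℕ) :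
    symbolicPower P n = Ideal.comap (algebraMap R (Localization.AtPrime P))
      (maximalIdeal (Localization.AtPrime P) ^ n) := by
  have h (Q : Ideal R) : IsAssociatedPrime Q (R ⧸ P) ↔ Q = P := by
    change Q ∈ associatedPrimes R (R ⧸ P) ↔ _
    rw [associatedPrimes.eq_singleton_of_isPrimary (Ideal.IsPrime.isPrimary ‹_›),
      Ideal.IsPrime.radical ‹_›, Set.mem_singleton_iff]
  have hP := (h P).mpr rfl
  unfold symbolicPower
  refine le_antisymm ((iInf₂_le P hP).trans ?_) (le_iInf₂ fun Q hQ => ?_)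
  · rw [Ideal.map_pow, Localization.AtPrime.map_eq_maximalIdeal]
  · obtain rfl := (h Q).mp hQ
    rw [Ideal.map_pow, Localization.AtPrime.map_eq_maximalIdeal]

theorem mem_symbolicPower_iff [IsNoetherianRing R] (n : ℕ) (f : R) :
    f ∈ symbolicPower P n ↔ ∃ s ∉ P, s * f ∈ P ^ n := by
  rw [symbolicPower_eq_comap, Ideal.mem_comap, ← Localization.AtPrime.map_eq_maximalIdeal,
    ← Ideal.map_pow, IsLocalization.algebraMap_mem_map_algebraMap_iff P.primeCompl]
  rfl

theorem symbolicPower_one [IsNoetherianRing R] : symbolicPower P 1 = P := by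
  rw [symbolicPower_eq_comap, pow_one]
  exact Localization.AtPrime.under_maximalIdeal

theorem symbolicPower_antitone [IsNoetherianRing R] : Antitone (symbolicPower P) := by
  intro m n h
  rw [symbolicPower_eq_comap, symbolicPower_eq_comap]
  exact Ideal.comap_mono (Ideal.pow_le_pow_right h)

theorem Derivation.map_mem_pow {k : Type*} [CommRing k] [Algebra k R] (D : Derivation k R R)
    (I : Ideal R) {m : ℕ} {f : R} (hf : f ∈ I ^ (m + 1)) : D f ∈ I ^ m := by
  induction m generalizing f with
  | zero => simp
  | succ m ih =>
    rw [pow_succ] at hf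
    refine Submodule.mul_induction_on hf (fun x hx y hy => ?_) fun x y hx hy => ?_
    · rw [D.leibniz]
      refine add_mem (Ideal.mul_mem_right _ _ hx) ?_
      rw [smul_eq_mul, mul_comm, pow_succ]
      exact Ideal.mul_mem_mul (ih hx) hy
    · rw [map_add]
      exact add_mem hx hy

theorem Derivation.map_mem_symbolicPower [IsNoetherianRing R] {k : Type*} [CommRing k]
    [Algebra k R] (D : Derivation k R R) {m : ℕ} {f : R} (hf : f ∈ symbolicPower P (m + 1)) :
    D f ∈ symbolicPower P m := by
  obtain ⟨s, hs, hsf⟩ := (mem_symbolicPower_iff P _ f).mp hf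
  refine (mem_symbolicPower_iff P _ _).mpr ⟨s * s, fun h => ?_, ?_⟩
  · exact (Ideal.IsPrime.mem_or_mem ‹_› h).elim hs hs
  · have h : s * s * D f = s * D (s * f) - D s * (s * f) := by
      rw [D.leibniz, smul_eq_mul, smul_eq_mul]
      ring
    rw [h]
    exact sub_mem (Ideal.mul_mem_left _ _ (D.map_mem_pow P hsf))
      (Ideal.mul_mem_left _ _ (Ideal.pow_le_pow_right m.le_succ hsf))

end symbolicPower

section Euler

open IsLocalRing TensorProduct

/-- A derivation that is congruent to the inclusion on an ideal `P` modulo the square of an ideal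
`I` containing `P` acts on `P ^ m` modulo `I ^ (m + 1)` as multiplication by `m`. -/
theorem Derivation.sub_natCast_mul_mem_pow {k R A : Type*} [CommRing k] [CommRing R] [CommRing A]
    [Algebra k R] [Algebra k A] [Algebra R A] (E : Derivation k R A)
    (P : Ideal R) (I : Ideal A) (hPI : ∀ y ∈ P, algebraMap R A y ∈ I)
    (hE : ∀ f, E f ∈ I) (hEP : ∀ y ∈ P, E y - algebraMap R A y ∈ I ^ 2)
    {m : ℕ} {f : R} (hf : f ∈ P ^ m) : E f - m * algebraMap R A f ∈ I ^ (m + 1) := by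
  induction m generalizing f with
  | zero => simpa using hE f
  | succ m ih =>
    rw [pow_succ] at hf
    refine Submodule.mul_induction_on hf (fun x hx y hy => ?_) fun x y hx hy => ?_
    · have hxI : algebraMap R A x ∈ I ^ m := by
        have hle : P.map (algebraMap R A) ≤ I := Ideal.map_le_iff_le_comap.mpr hPI
        refine Ideal.pow_right_mono hle m ?_
        rw [← Ideal.map_pow]
        exact Ideal.mem_map_of_mem _ hx
      have h : E (x * y) - ((m + 1 : ℕ) : A) * algebraMap R A (x * y) =
          algebraMap R A x * (E y - algebraMap R A y) +
            (E x - m * algebraMap R A x) * algebraMap R A y := by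
        rw [E.leibniz, Algebra.smul_def, Algebra.smul_def, map_mul]
        push_cast
        ring
      rw [h]
      refine add_mem ?_ ?_
      · rw [add_assoc m 1 1, pow_add]
        exact Ideal.mul_mem_mul hxI (hEP y hy)
      · rw [pow_succ _ (m + 1)]
        exact Ideal.mul_mem_mul (ih hx) (hPI y hy)
    · have h : E (x + y) - ((m + 1 : ℕ) : A) * algebraMap R A (x + y) =
          (E x - ((m + 1 : ℕ) : A) * algebraMap R A x) +
            (E y - ((m + 1 : ℕ) : A) * algebraMap R A y) := by
        rw [map_add, map_add]
        ring
      rw [h]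
      exact add_mem hx hy

variable {k : Type*} [Field k] {σ : Type*}
  (P : Ideal (MvPolynomial σ k)) [P.IsPrime]

theorem exists_derivation_sub_algebraMap_mem_sq [PerfectField k] [Finite σ] :
    ∃ E : Derivation k (MvPolynomial σ k) (Localization.AtPrime P),
      (∀ f, E f ∈ maximalIdeal (Localization.AtPrime P)) ∧
      ∀ y ∈ P, E y - algebraMap _ (Localization.AtPrime P) y ∈
        maximalIdeal (Localization.AtPrime P) ^ 2 := by
  set A := Localization.AtPrime P
  have : Algebra.FormallySmooth (MvPolynomial σ k) A := .of_isLocalization P.primeCompl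
  have : Algebra.FormallySmooth k A := .comp k (MvPolynomial σ k) A
  have : Algebra.EssFiniteType (MvPolynomial σ k) A := .of_isLocalization _ P.primeCompl
  have : Algebra.EssFiniteType k A := .comp k (MvPolynomial σ k) A
  have : Algebra.EssFiniteType k (ResidueField A) := .comp k A _
  have : Algebra.FormallySmooth k (ResidueField A) := .of_perfectField
  let J := RingHom.ker (algebraMap A (ResidueField A))
  obtain ⟨l, hl⟩ := (Algebra.FormallySmooth.iff_split_injection (R := k) (P := A)
    (A := ResidueField A) residue_surjective).mp this
  have hJ : J = maximalIdeal A := ker_residue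
  let d : Derivation k (MvPolynomial σ k) J.Cotangent :=
    ((l ∘ₗ (TensorProduct.mk A (ResidueField A) (Ω[A⁄k]) 1)).compDer
      (KaehlerDifferential.D k A)).compAlgebraMap (MvPolynomial σ k)
  choose p hp using fun i => J.toCotangent_surjective (d (MvPolynomial.X i))
  let E : Derivation k (MvPolynomial σ k) J := MvPolynomial.mkDerivation k p
  have hEd : (J.toCotangent.restrictScalars (MvPolynomial σ k)).compDer E = d :=
    MvPolynomial.derivation_ext fun i => by simp [E, hp]
  refine ⟨(J.subtype.restrictScalars (MvPolynomial σ k)).compDer E, fun f => hJ ▸ (E f).2,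
    fun y hy => ?_⟩
  have hyJ : algebraMap _ A y ∈ J := by
    rw [hJ, ← Localization.AtPrime.map_eq_maximalIdeal]
    exact Ideal.mem_map_of_mem _ hy
  have hdy : d y = J.toCotangent ⟨_, hyJ⟩ := DFunLike.congr_fun hl (J.toCotangent ⟨_, hyJ⟩)
  rw [← hEd] at hdy
  rw [← hJ]
  exact J.toCotangent_eq.mp hdy

theorem mem_symbolicPower_succ_of_pderiv_mem [CharZero k] [Finite σ] {m : ℕ} (hm : m ≠ 0)
    {f : MvPolynomial σ k} (hf : f ∈ symbolicPower P m)
    (hd : ∀ i, MvPolynomial.pderiv i f ∈ symbolicPower P m) : f ∈ symbolicPower P (m + 1) := by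
  have := Fintype.ofFinite σ
  obtain ⟨E, hE, hEP⟩ := exists_derivation_sub_algebraMap_mem_sq P
  obtain ⟨s, hs, hsf⟩ := (mem_symbolicPower_iff P m f).mp hf
  simp only [symbolicPower_eq_comap, Ideal.mem_comap] at hf hd ⊢
  set A := Localization.AtPrime P
  have hEf : E f ∈ maximalIdeal A ^ (m + 1) := by
    rw [MvPolynomial.derivation_eq_sum_pderiv_smul]
    refine sum_mem fun i _ => ?_
    rw [Algebra.smul_def, pow_succ]
    exact Ideal.mul_mem_mul (hd i) (hE _)
  have hmul := E.sub_natCast_mul_mem_pow P (maximalIdeal A)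
    (fun y hy => by
      rw [← Localization.AtPrime.map_eq_maximalIdeal]
      exact Ideal.mem_map_of_mem _ hy) hE hEP hsf
  have hsm : (m : A) * algebraMap _ A s * algebraMap _ A f ∈ maximalIdeal A ^ (m + 1) := by
    have h : (m : A) * algebraMap _ A s * algebraMap _ A f =
        algebraMap _ A s * E f + algebraMap _ A f * E s -
          (E (s * f) - m * algebraMap _ A (s * f)) := by
      rw [E.leibniz, Algebra.smul_def, Algebra.smul_def, map_mul]
      ring
    rw [h]
    refine sub_mem (add_mem (Ideal.mul_mem_left _ _ hEf) ?_) hmul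
    rw [pow_succ]
    exact Ideal.mul_mem_mul hf (hE s)
  have hmu : IsUnit (m : A) := by
    rw [← map_natCast (algebraMap k A)]
    exact (IsUnit.mk0 (m : k) (Nat.cast_ne_zero.mpr hm)).map _
  have hsu : IsUnit (algebraMap _ A s) := IsLocalization.map_units A (⟨s, hs⟩ : P.primeCompl)
  exact ((maximalIdeal A ^ (m + 1)).unit_mul_mem_iff_mem (hmu.mul hsu)).mp hsm

theorem mem_symbolicPower_succ_iff [CharZero k] [Finite σ] {m : ℕ} {f : MvPolynomial σ k} :
    f ∈ symbolicPower P (m + 1) ↔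
      f ∈ P ∧ ∀ i, MvPolynomial.pderiv i f ∈ symbolicPower P m := by
  constructor
  · intro h
    exact ⟨symbolicPower_one P ▸ symbolicPower_antitone P (by omega) h,
      fun i => (MvPolynomial.pderiv i).map_mem_symbolicPower P h⟩
  · rintro ⟨h, hd⟩
    induction m with
    | zero => rwa [zero_add, symbolicPower_one]
    | succ m ih =>
      exact mem_symbolicPower_succ_of_pderiv_mem P m.succ_ne_zero
        (ih fun i => symbolicPower_antitone P m.le_succ (hd i)) hd

end Euler

/-- **Zariski–Nagata.** Over a field of characteristic zero, the `n`-th symbolic power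
of a prime ideal `P` of a polynomial ring equals its `n`-th differential power: the set
of polynomials all of whose partial derivatives of order at most `n - 1` lie in `P`. -/
theorem symbolicPower_eq_differentialPower
    {k : Type*} [Field k] [CharZero k] {N : ℕ}
    (P : Ideal (MvPolynomial (Fin N) k)) [P.IsPrime] (n : ℕ) (hn : 0 < n)
    (f : MvPolynomial (Fin N) k) :
    f ∈ symbolicPower P n ↔
      ∀ a : Fin N → ℕ, (∑ i, a i) ≤ n - 1 → iteratedPDeriv a f ∈ P := by
  obtain ⟨m, rfl⟩ := Nat.exists_eq_add_one_of_ne_zero hn.ne'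
  rw [Nat.add_sub_cancel]
  induction m generalizing f with
  | zero =>
    rw [zero_add, symbolicPower_one]
    refine ⟨fun h a ha => ?_, fun h => iteratedPDeriv_zero f ▸ h 0 (by simp)⟩
    have ha0 : a = 0 := by
      ext i
      simpa using (Finset.single_le_sum (fun i _ => (a i).zero_le) (Finset.mem_univ i)).trans ha
    rwa [ha0, iteratedPDeriv_zero]
  | succ m ih =>
    rw [mem_symbolicPower_succ_iff, forall_iteratedPDeriv_mem_succ_iff]
    exact and_congr_right fun _ => forall_congr' fun i => ih _ m.succ_pos
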